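/- In Euclidean space ℝ³, for every t₀ > 0 let L̃ = {(s, exp s, t₀/2 + exp s) : s ∈ ℝ} ∪ {(s, −exp s, −t₀/2 − exp s) : s ∈ ℝ}, and let T_{t₀} : ℝ³ → ℝ³ be the translation T_{t₀}(a, b, c) = (a, b, c + t₀). Then L̃ and T_{t₀}(L̃) are disjoint, yet inf{dist(x, T_{t₀}(x')) : x, x' ∈ L̃} = 0; that is, for every ε > 0 there exist x, x' ∈ L̃ with dist(x, T_{t₀}(x')) < ε. -/

import Mathlib

/-- Remark 3.20. In Euclidean `ℝ³`, for `t₀ > 0`, the set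
`L̃ = {(s, eˢ, t₀/2 + eˢ)} ∪ {(s, −eˢ, −t₀/2 − eˢ)}` and its image under the translation
`T_{t₀}(a,b,c) = (a,b,c+t₀)` are disjoint, yet `inf {dist(x, T_{t₀} x') : x, x' ∈ L̃} = 0`. -/
theorem stmt_3 (t₀ : ℝ) (ht₀ : 0 < t₀)
    (T : EuclideanSpace ℝ (Fin 3) → EuclideanSpace ℝ (Fin 3))
    (hT : ∀ p, T p = (WithLp.equiv 2 (Fin 3 → ℝ)).symm ![p 0, p 1, p 2 + t₀])
    (Lt : Set (EuclideanSpace ℝ (Fin 3)))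
    (hLt : Lt = (Set.range fun s : ℝ =>
        (WithLp.equiv 2 (Fin 3 → ℝ)).symm ![s, Real.exp s, t₀ / 2 + Real.exp s]) ∪
      (Set.range fun s : ℝ =>
        (WithLp.equiv 2 (Fin 3 → ℝ)).symm ![s, -Real.exp s, -(t₀ / 2) - Real.exp s])) :
    Disjoint Lt (T '' Lt) ∧ ∀ ε > 0, ∃ x ∈ Lt, ∃ x' ∈ Lt, dist x (T x') < ε := by
  subst hLt
  refine ⟨?_, ?_⟩
  · rw [Set.disjoint_left]
    rintro x hx ⟨y, hy, rfl⟩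
    rw [hT] at hx
    rcases hx with ⟨s, hs⟩ | ⟨s, hs⟩ <;> rcases hy with ⟨r, rfl⟩ | ⟨r, rfl⟩ <;>
    · have h0 := congrArg (fun p : EuclideanSpace ℝ (Fin 3) => p 0) hs
      have h1 := congrArg (fun p : EuclideanSpace ℝ (Fin 3) => p 1) hs
      have h2 := congrArg (fun p : EuclideanSpace ℝ (Fin 3) => p 2) hs
      simp [-Real.exp_eq_exp] at h0 h1 h2
      have := Real.exp_pos s
      have := Real.exp_pos r
      linarith
  · intro ε hε
    refine ⟨_, Or.inl ⟨Real.log (ε / 3), rfl⟩, _, Or.inr ⟨Real.log (ε / 3), rfl⟩, ?_⟩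
    rw [hT, EuclideanSpace.dist_eq, Real.sqrt_lt' hε]
    simp [Fin.sum_univ_three, Real.dist_eq, Real.exp_log (show 0 < ε / 3 by positivity)]
    nlinarith [mul_pos hε hε]
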